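/- In the setting of the inexact augmented Lagrangian method for constrained Lasso, suppose additionally that ζ_k ∈ [0,1) with Σ_k ζ_k < ∞ and the iterates satisfy both criterion (A) and criterion (B): Θ_k(z^{k+1}) − inf Θ_k ≤ ζ_k²‖x^{k+1} − x^k‖²/(2σ_k), so that x^k → x^∞ ∈ S. Suppose the following metric subregularity condition holds at x^∞ with modulus κ_φ > 0: there exist ε > 0 and δ > 0 such that for every x with Bx = d and ‖x − x^∞‖ < ε, and every g ∈ ℝⁿ with ‖g‖ < δ satisfying f(x') ≥ f(x) + ⟨g, x' − x⟩ for all x' with Bx' = d, one has dist(x, S) ≤ κ_φ‖g‖. Then for all sufficiently large k: (i) dist(x^{k+1}, S) ≤ ρ_k · dist(x^k, S) where ρ_k = (κ_φ/√(κ_φ² + σ_k²) + 2ζ_k)(1 − ζ_k)⁻¹ < 1, and ρ_k → κ_φ/√(κ_φ² + σ_∞²) (which is 0 if σ_k → ∞); (ii) ‖Aᵀu^{k+1} − Bᵀv^{k+1} + w^{k+1}‖ ≤ ς_k · dist(x^k, S) with ς_k = σ_k⁻¹(1 − ζ_k)⁻¹; (iii) g(z^{k+1}) − inf g ≤ ς'_k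 · dist(x^k, S) with ς'_k = ς_k(ζ_k²‖x^{k+1} − x^k‖ + ‖x^{k+1}‖ + ‖x^k‖)/2. -/

import Mathlib

open Matrix

/-- Euclidean norm on `Fin n → ℝ`. -/
noncomputable def euclNorm {n : ℕ} (x : Fin n → ℝ) : ℝ := Real.sqrt (∑ i, x i ^ 2)

/-- Euclidean inner product on `Fin n → ℝ`. -/
def dotp {n : ℕ} (x y : Fin n → ℝ) : ℝ := ∑ i, x i * y i

/-- ℓ₁ norm on `Fin n → ℝ`. -/
def l1norm {n : ℕ} (x : Fin n → ℝ) : ℝ := ∑ i, |x i|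

/-- Euclidean distance from a point to a set: `inf_{y ∈ S} ‖x − y‖`. -/
noncomputable def distSet {n : ℕ} (x : Fin n → ℝ) (S : Set (Fin n → ℝ)) : ℝ :=
  sInf ((fun y => euclNorm (x - y)) '' S)

/-- Subdifferential of a (convex) function `g` at `x`. -/
def subdiff {n : ℕ} (g : (Fin n → ℝ) → ℝ) (x : Fin n → ℝ) : Set (Fin n → ℝ) :=
  {s : Fin n → ℝ | ∀ y, g y ≥ g x + dotp s (y - x)}

open Filter Topology

section EuclideanNorm

variable {n : ℕ}

theorem dotp_eq_dotProduct (x y : Fin n → ℝ) : dotp x y = x ⬝ᵥ y := rfl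

theorem euclNorm_eq_norm (x : Fin n → ℝ) : euclNorm x = ‖WithLp.toLp 2 x‖ := by
  simp [euclNorm, EuclideanSpace.norm_eq]

theorem euclNorm_nonneg (x : Fin n → ℝ) : 0 ≤ euclNorm x := Real.sqrt_nonneg _

theorem euclNorm_sq (x : Fin n → ℝ) : euclNorm x ^ 2 = x ⬝ᵥ x := by
  rw [euclNorm, Real.sq_sqrt (Finset.sum_nonneg fun i _ => sq_nonneg _)]
  simp [dotProduct, sq]

theorem euclNorm_smul (c : ℝ) (x : Fin n → ℝ) : euclNorm (c • x) = |c| * euclNorm x := by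
  simp [euclNorm_eq_norm, WithLp.toLp_smul, norm_smul]

theorem euclNorm_sub_comm (x y : Fin n → ℝ) : euclNorm (x - y) = euclNorm (y - x) := by
  simp only [euclNorm_eq_norm, WithLp.toLp_sub]
  exact norm_sub_rev _ _

theorem euclNorm_sub_le (x y z : Fin n → ℝ) :
    euclNorm (x - z) ≤ euclNorm (x - y) + euclNorm (y - z) := by
  simp only [euclNorm_eq_norm, WithLp.toLp_sub]
  exact norm_sub_le_norm_sub_add_norm_sub _ _ _

theorem euclNorm_sub_euclNorm_le (x y : Fin n → ℝ) :
    euclNorm x - euclNorm y ≤ euclNorm (x - y) := by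
  simp only [euclNorm_eq_norm, WithLp.toLp_sub]
  exact norm_sub_norm_le _ _

theorem continuous_euclNorm : Continuous (euclNorm : (Fin n → ℝ) → ℝ) := by
  unfold euclNorm
  fun_prop

theorem abs_apply_le_euclNorm (x : Fin n → ℝ) (i : Fin n) : |x i| ≤ euclNorm x :=
  Real.abs_le_sqrt (Finset.single_le_sum (f := fun j => x j ^ 2)
    (fun _ _ => sq_nonneg _) (Finset.mem_univ i))

theorem distSet_le {S : Set (Fin n → ℝ)} {y : Fin n → ℝ} (hy : y ∈ S) (x : Fin n → ℝ) :
    distSet x S ≤ euclNorm (x - y) :=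
  csInf_le ⟨0, by rintro _ ⟨z, -, rfl⟩; exact euclNorm_nonneg _⟩ ⟨y, hy, rfl⟩

theorem le_distSet {S : Set (Fin n → ℝ)} (hS : S.Nonempty) {x : Fin n → ℝ} {c : ℝ}
    (h : ∀ y ∈ S, c ≤ euclNorm (x - y)) : c ≤ distSet x S :=
  le_csInf (hS.image _) (by rintro _ ⟨y, hy, rfl⟩; exact h y hy)

theorem distSet_nonneg (x : Fin n → ℝ) (S : Set (Fin n → ℝ)) : 0 ≤ distSet x S :=
  Real.sInf_nonneg (by rintro _ ⟨y, -, rfl⟩; exact euclNorm_nonneg _)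

theorem distSet_le_add {S : Set (Fin n → ℝ)} (hS : S.Nonempty) (x y : Fin n → ℝ) :
    distSet x S ≤ euclNorm (x - y) + distSet y S := by
  have : distSet x S - euclNorm (x - y) ≤ distSet y S := le_distSet hS fun z hz => by
    linarith [distSet_le hz x, euclNorm_sub_le x y z]
  linarith

end EuclideanNorm

/-- The Lasso objective. -/
noncomputable def lasso {m n : ℕ} (A : Matrix (Fin m) (Fin n) ℝ) (b : Fin m → ℝ) (lam : ℝ)
    (x : Fin n → ℝ) : ℝ :=
  (1 / 2) * euclNorm (A *ᵥ x - b) ^ 2 + lam * l1norm x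

/-- The dual objective of the constrained Lasso. -/
noncomputable def dualLasso {m s : ℕ} (b : Fin m → ℝ) (d : Fin s → ℝ) (u : Fin m → ℝ)
    (v : Fin s → ℝ) : ℝ :=
  (1 / 2) * euclNorm u ^ 2 + dotp b u - dotp d v

/-- The augmented Lagrangian of the dual of the constrained Lasso. -/
noncomputable def augLagrangian {m n s : ℕ} (A : Matrix (Fin m) (Fin n) ℝ) (b : Fin m → ℝ)
    (B : Matrix (Fin s) (Fin n) ℝ) (d : Fin s → ℝ) (σ : ℝ) (u : Fin m → ℝ) (v : Fin s → ℝ)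
    (w x : Fin n → ℝ) : ℝ :=
  (1 / 2) * euclNorm u ^ 2 + dotp b u - dotp d v
    - dotp x (Aᵀ *ᵥ u - Bᵀ *ᵥ v + w)
    + (σ / 2) * euclNorm (Aᵀ *ᵥ u - Bᵀ *ᵥ v + w) ^ 2

section ProximalPoint

variable {m n s : ℕ} (A : Matrix (Fin m) (Fin n) ℝ) (b : Fin m → ℝ)
  (B : Matrix (Fin s) (Fin n) ℝ) (d : Fin s → ℝ) {lam σ : ℝ}

theorem continuous_lasso : Continuous (lasso A b lam) := by
  unfold lasso l1norm
  have : Continuous fun x => euclNorm (A *ᵥ x - b) :=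
    continuous_euclNorm.comp (by fun_prop)
  fun_prop

theorem lasso_nonneg (hlam : 0 ≤ lam) (x : Fin n → ℝ) : 0 ≤ lasso A b lam x := by
  have : 0 ≤ l1norm x := Finset.sum_nonneg fun i _ => abs_nonneg _
  unfold lasso
  positivity

theorem dotProduct_le_l1norm {w : Fin n → ℝ} (hw : ∀ i, |w i| ≤ lam) (x : Fin n → ℝ) :
    w ⬝ᵥ x ≤ lam * l1norm x := by
  rw [l1norm, Finset.mul_sum]
  refine Finset.sum_le_sum fun i _ => (le_abs_self _).trans ?_
  rw [abs_mul]
  exact mul_le_mul_of_nonneg_right (hw i) (abs_nonneg _)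

/-- The proximal subproblem of the constrained Lasso has a solution. -/
theorem exists_isMinOn_lasso_prox (hlam : 0 ≤ lam) (hσ : 0 < σ)
    (hC : ∃ y, B *ᵥ y = d) (x : Fin n → ℝ) :
    ∃ p, B *ᵥ p = d ∧ ∀ y, B *ᵥ y = d →
      lasso A b lam p + (1 / (2 * σ)) * euclNorm (p - x) ^ 2 ≤
        lasso A b lam y + (1 / (2 * σ)) * euclNorm (y - x) ^ 2 := by
  obtain ⟨y₀, hy₀⟩ := hC
  set F : (Fin n → ℝ) → ℝ := fun y => lasso A b lam y + (1 / (2 * σ)) * euclNorm (y - x) ^ 2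
    with hF
  have hFc : Continuous F := by
    have h1 : Continuous fun y => euclNorm (y - x) :=
      continuous_euclNorm.comp (by fun_prop)
    have h2 := continuous_lasso A b (lam := lam)
    fun_prop
  have hclosed : IsClosed {y | B *ᵥ y = d ∧ F y ≤ F y₀} :=
    (isClosed_eq (by fun_prop) continuous_const).inter (isClosed_le hFc continuous_const)
  have hcompact : IsCompact {y | B *ᵥ y = d ∧ F y ≤ F y₀} := by
    set R := Real.sqrt (2 * σ * F y₀) with hR
    refine (isCompact_Icc (a := fun i => x i - R) (b := fun i => x i + R)).of_isClosed_subset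
      hclosed ?_
    rintro y ⟨-, hy⟩
    have hle : euclNorm (y - x) ≤ R := by
      refine Real.le_sqrt_of_sq_le ?_
      have h0 := lasso_nonneg A b hlam y
      have h1 : (1 / (2 * σ)) * euclNorm (y - x) ^ 2 ≤ F y₀ := by
        simp only [hF] at hy ⊢
        linarith
      calc euclNorm (y - x) ^ 2 = 2 * σ * ((1 / (2 * σ)) * euclNorm (y - x) ^ 2) := by
            field_simp
        _ ≤ _ := by gcongr
    have hi : ∀ i, |y i - x i| ≤ R := fun i => (abs_apply_le_euclNorm (y - x) i).trans hle
    exact ⟨fun i => by have := abs_le.1 (hi i); linarith [this.1],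
      fun i => by have := abs_le.1 (hi i); linarith [this.2]⟩
  obtain ⟨p, ⟨hp, hp0⟩, hmin⟩ :=
    hcompact.exists_isMinOn ⟨y₀, hy₀, le_refl _⟩ hFc.continuousOn
  refine ⟨p, hp, fun y hy => ?_⟩
  rcases le_total (F y) (F y₀) with h | h
  · exact hmin ⟨hy, h⟩
  · exact hp0.trans h

/-- Along a ray the ℓ₁ norm is eventually linear, with slope given by a subgradient. -/
theorem exists_subgradient_l1norm_ray (hlam : 0 ≤ lam) (p h : Fin n → ℝ) :
    ∃ w : Fin n → ℝ, (∀ i, |w i| ≤ lam ∧ w i * p i = lam * |p i|) ∧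
      ∀ᶠ t in 𝓝[>] (0 : ℝ), lam * l1norm (p + t • h) = lam * l1norm p + t * (w ⬝ᵥ h) := by
  have key : ∀ i, ∃ c : ℝ, (|c| ≤ lam ∧ c * p i = lam * |p i|) ∧
      ∀ᶠ t in 𝓝[>] (0 : ℝ), lam * |p i + t * h i| = lam * |p i| + t * (c * h i) := by
    intro i
    have hcont : Tendsto (fun t : ℝ => p i + t * h i) (𝓝[>] 0) (𝓝 (p i)) := by
      have : Continuous fun t : ℝ => p i + t * h i := by fun_prop
      exact (this.tendsto' 0 _ (by simp)).mono_left nhdsWithin_le_nhds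
    rcases lt_trichotomy (p i) 0 with hp | hp | hp
    · refine ⟨-lam, ⟨by simp [abs_of_nonneg hlam], by rw [abs_of_neg hp]; ring⟩, ?_⟩
      filter_upwards [hcont.eventually_lt_const hp] with t ht
      rw [abs_of_neg ht, abs_of_neg hp]
      ring
    · rcases le_total 0 (h i) with hh | hh
      · refine ⟨lam, ⟨by simp [abs_of_nonneg hlam], by simp [hp]⟩, ?_⟩
        filter_upwards [self_mem_nhdsWithin] with t ht
        rw [hp, abs_of_nonneg (by have := mul_nonneg (le_of_lt ht) hh; linarith)]
        simp only [abs_zero, mul_zero, zero_add]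
        ring
      · refine ⟨-lam, ⟨by simp [abs_of_nonneg hlam], by simp [hp]⟩, ?_⟩
        filter_upwards [self_mem_nhdsWithin] with t ht
        rw [hp, abs_of_nonpos (by
          have := mul_nonpos_of_nonneg_of_nonpos (le_of_lt ht) hh; linarith)]
        simp only [abs_zero, mul_zero, zero_add]
        ring
    · refine ⟨lam, ⟨by simp [abs_of_nonneg hlam], by rw [abs_of_pos hp]⟩, ?_⟩
      filter_upwards [hcont.eventually_const_lt hp] with t ht
      rw [abs_of_pos ht, abs_of_pos hp]
      ring
  choose w hw hev using key
  refine ⟨w, hw, ?_⟩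
  filter_upwards [eventually_all.2 hev] with t ht
  simp only [l1norm, dotProduct, Finset.mul_sum, ← Finset.sum_add_distrib]
  exact Finset.sum_congr rfl fun i _ => by simpa using ht i

/-- First-order condition for the proximal subproblem along a feasible direction. -/
theorem exists_subgradient_dotProduct_nonneg (hlam : 0 ≤ lam) {p x h : Fin n → ℝ}
    (hp : B *ᵥ p = d) (hh : B *ᵥ h = 0)
    (hmin : ∀ y, B *ᵥ y = d →
      lasso A b lam p + (1 / (2 * σ)) * euclNorm (p - x) ^ 2 ≤
        lasso A b lam y + (1 / (2 * σ)) * euclNorm (y - x) ^ 2) :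
    ∃ w : Fin n → ℝ, (∀ i, |w i| ≤ lam ∧ w i * p i = lam * |p i|) ∧
      0 ≤ (Aᵀ *ᵥ (A *ᵥ p - b) + (1 / σ) • (p - x) + w) ⬝ᵥ h := by
  obtain ⟨w, hw, hev⟩ := exists_subgradient_l1norm_ray hlam p h
  refine ⟨w, hw, ?_⟩
  set D := (Aᵀ *ᵥ (A *ᵥ p - b) + (1 / σ) • (p - x) + w) ⬝ᵥ h with hD
  set c := (1 / 2) * ((A *ᵥ h) ⬝ᵥ (A *ᵥ h)) + (1 / (2 * σ)) * (h ⬝ᵥ h) with hc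
  have hev' : ∀ᶠ t in 𝓝[>] (0 : ℝ), 0 ≤ D + t * c := by
    filter_upwards [hev, self_mem_nhdsWithin] with t ht (htpos : 0 < t)
    have hm := hmin (p + t • h) (by rw [mulVec_add, mulVec_smul, hp, hh]; simp)
    have e1 : A *ᵥ (p + t • h) - b = (A *ᵥ p - b) + t • (A *ᵥ h) := by
      rw [mulVec_add, mulVec_smul]; abel
    have e2 : p + t • h - x = (p - x) + t • h := by abel
    have e3 : (Aᵀ *ᵥ (A *ᵥ p - b)) ⬝ᵥ h = (A *ᵥ p - b) ⬝ᵥ (A *ᵥ h) := by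
      rw [mulVec_transpose, dotProduct_mulVec]
    have hDe : D = (A *ᵥ p - b) ⬝ᵥ (A *ᵥ h) + (1 / σ) * ((p - x) ⬝ᵥ h) + w ⬝ᵥ h := by
      rw [hD, add_dotProduct, add_dotProduct, e3, smul_dotProduct, smul_eq_mul]
    unfold lasso at hm
    rw [ht, e1, e2] at hm
    simp only [euclNorm_sq] at hm
    generalize A *ᵥ p - b = r at *
    generalize A *ᵥ h = q at *
    generalize p - x = y at *
    simp only [add_dotProduct, dotProduct_add, smul_dotProduct, dotProduct_smul,
      smul_eq_mul, dotProduct_comm q r, dotProduct_comm h y] at hm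
    have : 0 ≤ t * (D + t * c) := by
      rw [hDe, hc]
      have e : 1 / σ = 2 * (1 / (2 * σ)) := by rw [one_div, one_div, mul_inv]; ring
      rw [e]
      nlinarith [hm]
    exact nonneg_of_mul_nonneg_right this htpos
  have hlim : Tendsto (fun t : ℝ => D + t * c) (𝓝[>] 0) (𝓝 D) := by
    have : Continuous fun t : ℝ => D + t * c := by fun_prop
    exact (this.tendsto' 0 _ (by simp)).mono_left nhdsWithin_le_nhds
  exact ge_of_tendsto hlim hev'

/-- The proximal point of the constrained Lasso together with its multipliers. -/
theorem exists_prox_multipliers (hlam : 0 ≤ lam) (hσ : 0 < σ)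
    (hC : ∃ y, B *ᵥ y = d) (x : Fin n → ℝ) :
    ∃ p v w, B *ᵥ p = d ∧ (∀ i, |w i| ≤ lam) ∧ w ⬝ᵥ p = lam * l1norm p ∧
      x - p = σ • (Aᵀ *ᵥ (A *ᵥ p - b) - Bᵀ *ᵥ v + w) := by
  obtain ⟨p, hp, hmin⟩ := exists_isMinOn_lasso_prox A b B d hlam hσ hC x
  set q := Aᵀ *ᵥ (A *ᵥ p - b) + (1 / σ) • (p - x) with hq
  set lo : Fin n → ℝ := fun i => if 0 < p i then lam else -lam with hlo
  set hi : Fin n → ℝ := fun i => if p i < 0 then -lam else lam with hhi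
  have mem_iff : ∀ w : Fin n → ℝ, w ∈ Set.Icc lo hi ↔
      ∀ i, |w i| ≤ lam ∧ w i * p i = lam * |p i| := by
    intro w
    rw [Set.mem_Icc, Pi.le_def, Pi.le_def, ← forall_and]
    refine forall_congr' fun i => ?_
    simp only [hlo, hhi, abs_le]
    rcases lt_trichotomy (p i) 0 with h | h | h
    · rw [if_neg h.not_gt, if_pos h, abs_of_neg h]
      constructor
      · rintro ⟨h1, h2⟩
        exact ⟨⟨h1, by linarith⟩, by rw [le_antisymm h2 h1]; ring⟩
      · rintro ⟨⟨h1, h2⟩, h3⟩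
        have : w i = -lam := mul_right_cancel₀ h.ne (by rw [h3]; ring)
        exact ⟨h1, this.le⟩
    · simp [h]
    · rw [if_pos h, if_neg h.not_gt, abs_of_pos h]
      constructor
      · rintro ⟨h1, h2⟩
        exact ⟨⟨by linarith, h2⟩, by rw [le_antisymm h2 h1]⟩
      · rintro ⟨⟨h1, h2⟩, h3⟩
        exact ⟨(mul_right_cancel₀ h.ne' h3).ge, h2⟩
  let V : Submodule ℝ (Fin n → ℝ) := LinearMap.range Bᵀ.mulVecLin
  have hmeet : ¬ Disjoint (Set.Icc (q + lo) (q + hi)) (V : Set (Fin n → ℝ)) := by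
    intro hdisj
    obtain ⟨l, c₁, c₂, h1, h12, h2⟩ := geometric_hahn_banach_compact_closed
      (convex_Icc _ _) isCompact_Icc V.convex V.closed_of_finiteDimensional hdisj
    have hc₂ : c₂ < 0 := by simpa using h2 0 V.zero_mem
    have hV : ∀ y ∈ V, l y = 0 := by
      intro y hy
      by_contra hne
      have := h2 ((c₂ / l y) • y) (V.smul_mem _ hy)
      rw [map_smul, smul_eq_mul, div_mul_cancel₀ _ hne] at this
      exact lt_irrefl _ this
    set h : Fin n → ℝ := fun i => l (Pi.single i 1) with hh
    have hl : ∀ y, l y = y ⬝ᵥ h := by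
      intro y
      conv_lhs => rw [pi_eq_sum_univ' y]
      simp [map_sum, dotProduct, hh, Pi.single]
    have hBh : B *ᵥ h = 0 := by
      refine dotProduct_self_eq_zero.1 ?_
      have := hV (Bᵀ *ᵥ (B *ᵥ h)) ⟨B *ᵥ h, rfl⟩
      rwa [hl, mulVec_transpose, ← dotProduct_mulVec] at this
    obtain ⟨w, hw, hnn⟩ := exists_subgradient_dotProduct_nonneg A b B d hlam hp hBh hmin
    obtain ⟨hw1, hw2⟩ := (mem_iff w).2 hw
    have := h1 (q + w) ⟨add_le_add_right hw1 q, add_le_add_right hw2 q⟩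
    rw [hl] at this
    linarith
  obtain ⟨y, ⟨hy1, hy2⟩, v, hv⟩ := Set.not_disjoint_iff.1 hmeet
  have hw := (mem_iff (y - q)).1
    ⟨le_sub_iff_add_le'.2 hy1, sub_le_iff_le_add'.2 hy2⟩
  refine ⟨p, v, y - q, hp, fun i => (hw i).1, ?_, ?_⟩
  · rw [l1norm, Finset.mul_sum]
    exact Finset.sum_congr rfl fun i _ => (hw i).2
  · rw [← hv, hq, mulVecLin_apply]
    simp only [smul_add, smul_sub, smul_smul, mul_one_div_cancel hσ.ne', one_smul]
    abel

/-- The proximal residual is a subgradient of the objective relative to the feasible set. -/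
theorem lasso_add_dotProduct_le {p r : Fin n → ℝ} {v : Fin s → ℝ} {w : Fin n → ℝ}
    (hp : B *ᵥ p = d) (hw : ∀ i, |w i| ≤ lam) (hwp : w ⬝ᵥ p = lam * l1norm p)
    (hr : r = Aᵀ *ᵥ (A *ᵥ p - b) - Bᵀ *ᵥ v + w) {y : Fin n → ℝ} (hy : B *ᵥ y = d) :
    lasso A b lam p + r ⬝ᵥ (y - p) ≤ lasso A b lam y := by
  have h1 := dotProduct_le_l1norm hw y
  have h2 : (Bᵀ *ᵥ v) ⬝ᵥ (y - p) = 0 := by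
    rw [mulVec_transpose, ← dotProduct_mulVec, mulVec_sub, hy, hp, sub_self, dotProduct_zero]
  have h3 : (Aᵀ *ᵥ (A *ᵥ p - b)) ⬝ᵥ (y - p) = (A *ᵥ p - b) ⬝ᵥ ((A *ᵥ y - b) - (A *ᵥ p - b)) := by
    rw [mulVec_transpose, ← dotProduct_mulVec, mulVec_sub]
    congr 1
    abel
  have h4 : 0 ≤ euclNorm ((A *ᵥ y - b) - (A *ᵥ p - b)) ^ 2 := sq_nonneg _
  rw [hr, add_dotProduct, sub_dotProduct, h2, h3, dotProduct_sub w, hwp]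
  unfold lasso
  simp only [euclNorm_sq] at *
  generalize A *ᵥ y - b = Y at *
  generalize A *ᵥ p - b = P at *
  simp only [sub_dotProduct, dotProduct_sub, dotProduct_comm Y P] at *
  linarith

/-- Quadratic expansion of the augmented Lagrangian in terms of the ordinary Lagrangian. -/
theorem augLagrangian_eq (hσ : 0 < σ) (u : Fin m → ℝ) (v : Fin s → ℝ) (w x p : Fin n → ℝ) :
    augLagrangian A b B d σ u v w x =
      dualLasso b d u v - p ⬝ᵥ (Aᵀ *ᵥ u - Bᵀ *ᵥ v + w)
        - (1 / (2 * σ)) * euclNorm (p - x) ^ 2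
        + (1 / (2 * σ)) *
          euclNorm (x - σ • (Aᵀ *ᵥ u - Bᵀ *ᵥ v + w) - p) ^ 2 := by
  unfold augLagrangian dualLasso
  generalize Aᵀ *ᵥ u - Bᵀ *ᵥ v + w = r
  simp only [euclNorm_sq, dotp_eq_dotProduct, sub_dotProduct, dotProduct_sub, smul_dotProduct,
    dotProduct_smul, smul_eq_mul, dotProduct_comm r, dotProduct_comm p x]
  field_simp
  ring

theorem lagrangian_eq {p : Fin n → ℝ} (hp : B *ᵥ p = d) (u : Fin m → ℝ) (v : Fin s → ℝ)
    (w : Fin n → ℝ) :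
    dualLasso b d u v - p ⬝ᵥ (Aᵀ *ᵥ u - Bᵀ *ᵥ v + w) =
      (1 / 2) * euclNorm (u - (A *ᵥ p - b)) ^ 2 - (1 / 2) * euclNorm (A *ᵥ p - b) ^ 2
        - w ⬝ᵥ p := by
  have h1 : p ⬝ᵥ (Aᵀ *ᵥ u) = (A *ᵥ p) ⬝ᵥ u := by
    rw [dotProduct_mulVec, vecMul_transpose]
  have h2 : p ⬝ᵥ (Bᵀ *ᵥ v) = d ⬝ᵥ v := by
    rw [dotProduct_mulVec, vecMul_transpose, hp]
  unfold dualLasso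
  rw [dotProduct_add, dotProduct_sub, h1, h2]
  generalize A *ᵥ p = P
  simp only [euclNorm_sq, dotp_eq_dotProduct, sub_dotProduct, dotProduct_sub,
    dotProduct_comm u, dotProduct_comm p w, dotProduct_comm P b]
  ring

/-- Weak duality, sharpened by the squared distance between the multiplier update and `p`. -/
theorem neg_lasso_add_le_augLagrangian (hσ : 0 < σ) {p : Fin n → ℝ} (hp : B *ᵥ p = d)
    (u : Fin m → ℝ) (v : Fin s → ℝ) {w : Fin n → ℝ} (hw : ∀ i, |w i| ≤ lam) (x : Fin n → ℝ) :
    -lasso A b lam p - (1 / (2 * σ)) * euclNorm (p - x) ^ 2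
        + (1 / (2 * σ)) * euclNorm (x - σ • (Aᵀ *ᵥ u - Bᵀ *ᵥ v + w) - p) ^ 2 ≤
      augLagrangian A b B d σ u v w x := by
  rw [augLagrangian_eq A b B d hσ u v w x p, lagrangian_eq A b B d hp]
  have h1 := dotProduct_le_l1norm hw p
  have h2 := sq_nonneg (euclNorm (u - (A *ᵥ p - b)))
  unfold lasso
  linarith

/-- The augmented Lagrangian in terms of the multiplier update. -/
theorem augLagrangian_eq_dualLasso (hσ : 0 < σ) (u : Fin m → ℝ) (v : Fin s → ℝ)
    (w x : Fin n → ℝ) :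
    augLagrangian A b B d σ u v w x = dualLasso b d u v
      + (1 / (2 * σ)) *
        (euclNorm (x - σ • (Aᵀ *ᵥ u - Bᵀ *ᵥ v + w)) ^ 2 - euclNorm x ^ 2) := by
  rw [augLagrangian_eq A b B d hσ u v w x 0, zero_dotProduct, euclNorm_sub_comm 0 x]
  simp only [sub_zero]
  ring

theorem bddBelow_augLagrangian (hσ : 0 < σ) (hC : ∃ y, B *ᵥ y = d) (x : Fin n → ℝ) :
    BddBelow {r | ∃ u' v' w', (∀ i, |w' i| ≤ lam) ∧
      r = augLagrangian A b B d σ u' v' w' x} := by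
  obtain ⟨y, hy⟩ := hC
  refine ⟨-lasso A b lam y - (1 / (2 * σ)) * euclNorm (y - x) ^ 2, ?_⟩
  rintro _ ⟨u, v, w, hw, rfl⟩
  refine le_trans ?_ (neg_lasso_add_le_augLagrangian A b B d hσ hy u v hw x)
  exact le_add_of_nonneg_right (by positivity)

/-- An inexact multiplier step stays within the subproblem error of the exact proximal point,
which itself is Fejér monotone with respect to the solution set. -/
theorem exists_prox_near_update (hlam : 0 ≤ lam) (hσ : 0 < σ) (hC : ∃ y, B *ᵥ y = d)
    (x : Fin n → ℝ) :
    ∃ p, B *ᵥ p = d ∧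
      (∀ y, B *ᵥ y = d →
        lasso A b lam p + ((1 / σ) • (x - p)) ⬝ᵥ (y - p) ≤ lasso A b lam y) ∧
      ∀ u v w, (∀ i, |w i| ≤ lam) →
        (1 / (2 * σ)) * euclNorm (x - σ • (Aᵀ *ᵥ u - Bᵀ *ᵥ v + w) - p) ^ 2 ≤
          augLagrangian A b B d σ u v w x -
            sInf {r | ∃ u' v' w', (∀ i, |w' i| ≤ lam) ∧
              r = augLagrangian A b B d σ u' v' w' x} := by
  obtain ⟨p, v₀, w₀, hp, hw₀, hwp, hxp⟩ := exists_prox_multipliers A b B d hlam hσ hC x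
  refine ⟨p, hp, fun y hy => ?_, fun u v w hw => ?_⟩
  · refine lasso_add_dotProduct_le A b B d hp hw₀ hwp (v := v₀) ?_ hy
    rw [hxp, smul_smul, one_div_mul_cancel hσ.ne', one_smul]
  · have hbound := neg_lasso_add_le_augLagrangian A b B d hσ hp u v hw x
    have hopt : augLagrangian A b B d σ (A *ᵥ p - b) v₀ w₀ x =
        -lasso A b lam p - (1 / (2 * σ)) * euclNorm (p - x) ^ 2 := by
      rw [augLagrangian_eq A b B d hσ _ _ _ _ p, lagrangian_eq A b B d hp, ← hxp, hwp]
      simp only [euclNorm_sq, sub_self, sub_sub_cancel, dotProduct_zero]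
      unfold lasso
      rw [euclNorm_sq]
      ring
    have hinf : sInf {r | ∃ u' v' w', (∀ i, |w' i| ≤ lam) ∧
        r = augLagrangian A b B d σ u' v' w' x} ≤
        augLagrangian A b B d σ (A *ᵥ p - b) v₀ w₀ x :=
      csInf_le (bddBelow_augLagrangian A b B d hσ hC x) ⟨_, _, _, hw₀, rfl⟩
    linarith

/-- The minimal value of the augmented Lagrangian is at most the dual optimal value. -/
theorem sInf_augLagrangian_le (hlam : 0 ≤ lam) (hσ : 0 < σ) (hC : ∃ y, B *ᵥ y = d)
    (x : Fin n → ℝ) :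
    sInf {r | ∃ u' v' w', (∀ i, |w' i| ≤ lam) ∧ r = augLagrangian A b B d σ u' v' w' x} ≤
      sInf {r | ∃ u' v', ∃ w' : Fin n → ℝ, (∀ i, |w' i| ≤ lam) ∧
        Aᵀ *ᵥ u' - Bᵀ *ᵥ v' + w' = 0 ∧ r = dualLasso b d u' v'} := by
  refine csInf_le_csInf (bddBelow_augLagrangian A b B d hσ hC x)
    ⟨_, 0, 0, 0, fun _ => by simpa using hlam, by simp, rfl⟩ ?_
  rintro _ ⟨u, v, w, hw, h0, rfl⟩
  refine ⟨u, v, w, hw, ?_⟩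
  rw [augLagrangian_eq_dualLasso A b B d hσ, h0]
  simp

end ProximalPoint

section Rates

/-- Contraction of the exact proximal step under metric subregularity. -/
theorem distSet_le_of_subregular {n : ℕ} {S : Set (Fin n → ℝ)} (hS : S.Nonempty)
    {κ σ : ℝ} (hκ : 0 < κ) (hσ : 0 < σ) {x p : Fin n → ℝ}
    (hfejer : ∀ y ∈ S, euclNorm (x - p) ^ 2 + euclNorm (p - y) ^ 2 ≤ euclNorm (x - y) ^ 2)
    (hsub : distSet p S ≤ κ * ((1 / σ) * euclNorm (x - p))) :
    distSet p S ≤ κ / Real.sqrt (κ ^ 2 + σ ^ 2) * distSet x S := by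
  have hp0 := distSet_nonneg p S
  have hx0 := distSet_nonneg x S
  have hsq : euclNorm (x - p) ^ 2 + distSet p S ^ 2 ≤ distSet x S ^ 2 := by
    rw [← Real.sqrt_le_left hx0]
    refine le_distSet hS fun y hy => Real.sqrt_le_iff.2 ⟨euclNorm_nonneg _, ?_⟩
    have := pow_le_pow_left₀ hp0 (distSet_le hy p) 2
    linarith [hfejer y hy]
  have h1 : σ * distSet p S ≤ κ * euclNorm (x - p) := by
    calc σ * distSet p S ≤ σ * (κ * ((1 / σ) * euclNorm (x - p))) := by gcongr
      _ = κ * euclNorm (x - p) := by field_simp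
  have h2 : (σ * distSet p S) ^ 2 ≤ (κ * euclNorm (x - p)) ^ 2 :=
    pow_le_pow_left₀ (by positivity) h1 2
  have hs : 0 < κ ^ 2 + σ ^ 2 := by positivity
  rw [div_mul_eq_mul_div, le_div_iff₀ (Real.sqrt_pos.2 hs)]
  refine le_of_sq_le_sq ?_ (by positivity)
  rw [mul_pow, mul_pow, Real.sq_sqrt hs.le]
  nlinarith [mul_le_mul_of_nonneg_left hsq (sq_nonneg κ)]

theorem tendsto_rate {κ θ : ℝ} {σ ζ : ℕ → ℝ} (hζ : Tendsto ζ atTop (𝓝 0))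
    (hθ : Tendsto (fun k => κ / Real.sqrt (κ ^ 2 + σ k ^ 2)) atTop (𝓝 θ)) :
    Tendsto (fun k => (κ / Real.sqrt (κ ^ 2 + σ k ^ 2) + 2 * ζ k) * (1 - ζ k)⁻¹)
      atTop (𝓝 θ) := by
  have h1 : Tendsto (fun k => (1 - ζ k)⁻¹) atTop (𝓝 (1 - 0)⁻¹) :=
    (tendsto_const_nhds.sub hζ).inv₀ (by norm_num)
  simpa using (hθ.add (hζ.const_mul 2)).mul h1

theorem eventually_rate_lt_one {κ : ℝ} (hκ : 0 < κ) {σ ζ : ℕ → ℝ} (hσpos : ∀ k, 0 < σ k)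
    (hσmono : Monotone σ) (hζ1 : ∀ k, ζ k < 1) (hζ : Tendsto ζ atTop (𝓝 0)) :
    ∀ᶠ k in atTop, (κ / Real.sqrt (κ ^ 2 + σ k ^ 2) + 2 * ζ k) * (1 - ζ k)⁻¹ < 1 := by
  have hlim : Tendsto (fun k => (κ / Real.sqrt (κ ^ 2 + σ 0 ^ 2) + 2 * ζ k) * (1 - ζ k)⁻¹)
      atTop (𝓝 (κ / Real.sqrt (κ ^ 2 + σ 0 ^ 2))) :=
    tendsto_rate (σ := fun _ => σ 0) hζ tendsto_const_nhds
  have h0 := hσpos 0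
  have hlt : κ / Real.sqrt (κ ^ 2 + σ 0 ^ 2) < 1 := by
    rw [div_lt_one (by positivity)]
    exact Real.lt_sqrt_of_sq_lt (by nlinarith)
  filter_upwards [hlim.eventually_lt_const hlt] with k hk
  refine lt_of_le_of_lt ?_ hk
  have := hσmono (Nat.zero_le k)
  have := inv_nonneg.2 (sub_nonneg.2 (hζ1 k).le)
  gcongr

end Rates

/-- **Local (super)linear convergence of the inexact augmented Lagrangian method**
(Theorem 3): under criteria (A) and (B), with `x^k → x^∞ ∈ S` and metric subregularity
of `T_φ` at `x^∞` for `0` with modulus `κ_φ`, for all sufficiently large `k`: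
`dist(x^{k+1},S) ≤ ρ_k dist(x^k,S)` with `ρ_k = (κ_φ/√(κ_φ²+σ_k²) + 2ζ_k)(1−ζ_k)⁻¹ < 1`,
`‖Aᵀu^{k+1} − Bᵀv^{k+1} + w^{k+1}‖ ≤ ς_k dist(x^k,S)`, and
`g(z^{k+1}) − inf g ≤ ς'_k dist(x^k,S)`; moreover `ρ_k → κ_φ/√(κ_φ²+σ_∞²)`
(and `ρ_k → 0` if `σ_k → ∞`). -/
theorem inexact_alm_local_linear_convergence
    {m n s : ℕ} (A : Matrix (Fin m) (Fin n) ℝ) (b : Fin m → ℝ)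
    (B : Matrix (Fin s) (Fin n) ℝ) (d : Fin s → ℝ)
    (lam : ℝ) (hlam : 0 < lam)
    (f : (Fin n → ℝ) → ℝ)
    (hf : f = fun x => (1 / 2) * euclNorm (A *ᵥ x - b) ^ 2 + lam * l1norm x)
    (S : Set (Fin n → ℝ))
    (hS : S = {x | B *ᵥ x = d ∧ ∀ y, B *ᵥ y = d → f x ≤ f y})
    (hSne : S.Nonempty)
    (L : ℝ → (Fin m → ℝ) → (Fin s → ℝ) → (Fin n → ℝ) → (Fin n → ℝ) → ℝ)
    (hL : L = fun σ u v w x =>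
      (1 / 2) * euclNorm u ^ 2 + dotp b u - dotp d v
        - dotp x (Aᵀ *ᵥ u - Bᵀ *ᵥ v + w)
        + (σ / 2) * euclNorm (Aᵀ *ᵥ u - Bᵀ *ᵥ v + w) ^ 2)
    (g : (Fin m → ℝ) → (Fin s → ℝ) → (Fin n → ℝ) → ℝ)
    (hg : g = fun u v _ => (1 / 2) * euclNorm u ^ 2 + dotp b u - dotp d v)
    (ginf : ℝ)
    (hginf : ginf = sInf {r | ∃ u' v' w', (∀ i, |w' i| ≤ lam) ∧
      Aᵀ *ᵥ u' - Bᵀ *ᵥ v' + w' = 0 ∧ r = g u' v' w'})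
    (σ : ℕ → ℝ) (hσpos : ∀ k, 0 < σ k) (hσmono : Monotone σ)
    (ε : ℕ → ℝ) (hεnonneg : ∀ k, 0 ≤ ε k) (hεsum : Summable ε)
    (ζ : ℕ → ℝ) (hζ : ∀ k, 0 ≤ ζ k ∧ ζ k < 1) (hζsum : Summable ζ)
    (u : ℕ → Fin m → ℝ) (v : ℕ → Fin s → ℝ) (w : ℕ → Fin n → ℝ) (x : ℕ → Fin n → ℝ)
    (hw : ∀ k i, |w k i| ≤ lam)
    (hxupd : ∀ k, x (k + 1) =
      x k - σ k • (Aᵀ *ᵥ u (k + 1) - Bᵀ *ᵥ v (k + 1) + w (k + 1)))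
    (Θinf : ℕ → ℝ)
    (hΘinf : ∀ k, Θinf k = sInf {r | ∃ u' v' w', (∀ i, |w' i| ≤ lam) ∧
      r = L (σ k) u' v' w' (x k)})
    -- stopping criterion (A)
    (hcritA : ∀ k,
      L (σ k) (u (k + 1)) (v (k + 1)) (w (k + 1)) (x k) - Θinf k ≤ ε k ^ 2 / (2 * σ k))
    -- stopping criterion (B)
    (hcritB : ∀ k,
      L (σ k) (u (k + 1)) (v (k + 1)) (w (k + 1)) (x k) - Θinf k ≤
        ζ k ^ 2 * euclNorm (x (k + 1) - x k) ^ 2 / (2 * σ k))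
    -- convergence of the primal iterates to `x^∞ ∈ S`
    (xinf : Fin n → ℝ) (hxinfS : xinf ∈ S)
    (hxconv : Filter.Tendsto (fun k => euclNorm (x k - xinf)) Filter.atTop (nhds 0))
    -- metric subregularity of `T_φ` at `x^∞` for `0` with modulus `κ_φ`
    (κφ : ℝ) (hκφ : 0 < κφ)
    (hsubreg : ∃ ε' > 0, ∃ δ > 0, ∀ x' : Fin n → ℝ,
      B *ᵥ x' = d → euclNorm (x' - xinf) < ε' →
        ∀ gr : Fin n → ℝ, euclNorm gr < δ →
          (∀ x'', B *ᵥ x'' = d → f x'' ≥ f x' + dotp gr (x'' - x')) →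
            distSet x' S ≤ κφ * euclNorm gr)
    -- the rate coefficients
    (ρ : ℕ → ℝ)
    (hρ : ρ = fun k => (κφ / Real.sqrt (κφ ^ 2 + σ k ^ 2) + 2 * ζ k) * (1 - ζ k)⁻¹)
    (ς : ℕ → ℝ) (hς : ς = fun k => (σ k)⁻¹ * (1 - ζ k)⁻¹)
    (ς' : ℕ → ℝ)
    (hς' : ς' = fun k => ς k * (ζ k ^ 2 * euclNorm (x (k + 1) - x k)
      + euclNorm (x (k + 1)) + euclNorm (x k)) / 2) :
    (∃ K, ∀ k ≥ K,
      (ρ k < 1 ∧ distSet (x (k + 1)) S ≤ ρ k * distSet (x k) S) ∧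
      euclNorm (Aᵀ *ᵥ u (k + 1) - Bᵀ *ᵥ v (k + 1) + w (k + 1)) ≤ ς k * distSet (x k) S ∧
      g (u (k + 1)) (v (k + 1)) (w (k + 1)) - ginf ≤ ς' k * distSet (x k) S) ∧
    (∀ σinf : ℝ, Filter.Tendsto σ Filter.atTop (nhds σinf) →
      Filter.Tendsto ρ Filter.atTop (nhds (κφ / Real.sqrt (κφ ^ 2 + σinf ^ 2)))) ∧
    (Filter.Tendsto σ Filter.atTop Filter.atTop →
      Filter.Tendsto ρ Filter.atTop (nhds 0)) := by
  obtain rfl : f = lasso A b lam := hf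
  obtain rfl : L = augLagrangian A b B d := hL
  obtain rfl : g = fun u v _ => dualLasso b d u v := hg
  have hC : ∃ y, B *ᵥ y = d := ⟨xinf, by rw [hS] at hxinfS; exact hxinfS.1⟩
  have hζ0 : Tendsto ζ atTop (𝓝 0) := hζsum.tendsto_atTop_zero
  choose p hpd hpsub hpnear using fun k =>
    exists_prox_near_update A b B d hlam.le (hσpos k) hC (x k)
  have hfejer : ∀ k, ∀ y ∈ S,
      euclNorm (x k - p k) ^ 2 + euclNorm (p k - y) ^ 2 ≤ euclNorm (x k - y) ^ 2 := by
    intro k y hy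
    rw [hS] at hy
    have h1 := hpsub k y hy.1
    have h2 := hy.2 (p k) (hpd k)
    rw [smul_dotProduct, smul_eq_mul] at h1
    have h3 : (x k - p k) ⬝ᵥ (y - p k) ≤ 0 :=
      nonpos_of_mul_nonpos_right (by linarith) (one_div_pos.2 (hσpos k))
    have h4 : x k - y = (x k - p k) - (y - p k) := by abel
    rw [euclNorm_sub_comm (p k) y, h4]
    generalize x k - p k = a at *
    generalize y - p k = c at *
    simp only [euclNorm_sq, sub_dotProduct, dotProduct_sub, dotProduct_comm c a]
    linarith
  have hprox_le : ∀ k, ∀ y ∈ S, euclNorm (x k - p k) ≤ euclNorm (x k - y) := fun k y hy =>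
    le_of_sq_le_sq (by linarith [hfejer k y hy, sq_nonneg (euclNorm (p k - y))])
      (euclNorm_nonneg _)
  have hprox_le' : ∀ k, ∀ y ∈ S, euclNorm (p k - y) ≤ euclNorm (x k - y) := fun k y hy =>
    le_of_sq_le_sq (by linarith [hfejer k y hy, sq_nonneg (euclNorm (x k - p k))])
      (euclNorm_nonneg _)
  have hnear : ∀ k, euclNorm (x (k + 1) - p k) ≤ ζ k * euclNorm (x (k + 1) - x k) := by
    intro k
    have h1 := (hpnear k _ (v (k + 1)) _ (hw (k + 1))).trans
      ((hΘinf k ▸ hcritB k :))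
    rw [← hxupd k, one_div_mul_eq_div, div_le_div_iff_of_pos_right (by linarith [hσpos k]),
      ← mul_pow] at h1
    exact le_of_sq_le_sq h1 (mul_nonneg (hζ k).1 (euclNorm_nonneg _))
  have hstep : ∀ k, euclNorm (x (k + 1) - x k) ≤ (1 - ζ k)⁻¹ * distSet (x k) S := by
    intro k
    have h1 : euclNorm (x k - p k) ≤ distSet (x k) S := le_distSet hSne (hprox_le k)
    have h2 := euclNorm_sub_le (x (k + 1)) (p k) (x k)
    rw [euclNorm_sub_comm (p k)] at h2
    rw [← div_eq_inv_mul, le_div_iff₀ (by linarith [(hζ k).2])]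
    linarith [hnear k]
  have hres : ∀ k, euclNorm (Aᵀ *ᵥ u (k + 1) - Bᵀ *ᵥ v (k + 1) + w (k + 1)) =
      (σ k)⁻¹ * euclNorm (x (k + 1) - x k) := by
    intro k
    rw [euclNorm_sub_comm, hxupd k, sub_sub_cancel, euclNorm_smul, abs_of_pos (hσpos k),
      inv_mul_cancel_left₀ (hσpos k).ne']
  have hres_le : ∀ k, (σ k)⁻¹ * euclNorm (x (k + 1) - x k) ≤ ς k * distSet (x k) S := by
    intro k
    rw [hς]
    simp only [mul_assoc]
    exact mul_le_mul_of_nonneg_left (hstep k) (inv_nonneg.2 (hσpos k).le)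
  refine ⟨?_, ?_, ?_⟩
  · obtain ⟨ε', hε', δ, hδ, hreg⟩ := hsubreg
    have hσ0 := hσpos 0
    obtain ⟨K, hK⟩ := eventually_atTop.1
      ((eventually_rate_lt_one hκφ hσpos hσmono (fun k => (hζ k).2) hζ0).and
        ((hxconv.eventually_lt_const hε').and
          (hxconv.eventually_lt_const (mul_pos hσ0 hδ))))
    refine ⟨K, fun k hk => ?_⟩
    obtain ⟨hρ1, hkε, hkδ⟩ := hK k hk
    have hσk := hσpos k
    have hζ1 : 0 < 1 - ζ k := by linarith [(hζ k).2]
    have hgr : euclNorm ((1 / σ k) • (x k - p k)) = (1 / σ k) * euclNorm (x k - p k) := by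
      rw [euclNorm_smul, abs_of_pos (one_div_pos.2 hσk)]
    refine ⟨⟨by rw [hρ]; exact hρ1, ?_⟩, (hres k).trans_le (hres_le k), ?_⟩
    · have hsub := hreg (p k) (hpd k) ((hprox_le' k xinf hxinfS).trans_lt hkε)
        ((1 / σ k) • (x k - p k)) (by
          rw [hgr, one_div_mul_eq_div, div_lt_iff₀ hσk]
          calc euclNorm (x k - p k) ≤ euclNorm (x k - xinf) := hprox_le k xinf hxinfS
            _ < σ 0 * δ := hkδ
            _ ≤ δ * σ k := by rw [mul_comm]; gcongr; exact hσmono (Nat.zero_le k))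
        (hpsub k)
      rw [hgr] at hsub
      have hcontr := distSet_le_of_subregular hSne hκφ hσk (hfejer k) hsub
      set θ := κφ / Real.sqrt (κφ ^ 2 + σ k ^ 2) with hθ
      have hθ0 : 0 ≤ θ := by positivity
      have hθ1 : θ ≤ 1 :=
        div_le_one_of_le₀ (Real.le_sqrt_of_sq_le (by nlinarith)) (Real.sqrt_nonneg _)
      have hD := distSet_nonneg (x k) S
      have h1 := distSet_le_add hSne (x (k + 1)) (p k)
      have h2 := mul_le_mul_of_nonneg_left (hstep k) (hζ k).1
      calc distSet (x (k + 1)) S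
          ≤ ζ k * ((1 - ζ k)⁻¹ * distSet (x k) S) + θ * distSet (x k) S := by
            linarith [hnear k]
        _ = ((θ * (1 - ζ k) + ζ k) * (1 - ζ k)⁻¹) * distSet (x k) S := by
            field_simp
            ring
        _ ≤ ρ k * distSet (x k) S := by
            rw [hρ]
            have := (hζ k).1
            have := mul_nonneg hθ0 this
            have := inv_nonneg.2 hζ1.le
            refine mul_le_mul_of_nonneg_right (mul_le_mul_of_nonneg_right ?_ this) hD
            linarith
    · have hinf : Θinf k ≤ ginf := by
        rw [hΘinf, hginf]
        exact sInf_augLagrangian_le A b B d hlam.le hσk hC (x k)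
      have hB := hcritB k
      rw [augLagrangian_eq_dualLasso A b B d hσk, ← hxupd k] at hB
      set a := euclNorm (x (k + 1) - x k) with ha
      have ha0 : 0 ≤ a := euclNorm_nonneg _
      have hx0 := euclNorm_nonneg (x k)
      have hx1 := euclNorm_nonneg (x (k + 1))
      have hdiff : euclNorm (x k) ^ 2 - euclNorm (x (k + 1)) ^ 2 ≤
          a * (euclNorm (x (k + 1)) + euclNorm (x k)) := by
        have := euclNorm_sub_euclNorm_le (x k) (x (k + 1))
        rw [euclNorm_sub_comm, ← ha] at this
        nlinarith
      set M := ζ k ^ 2 * a + euclNorm (x (k + 1)) + euclNorm (x k) with hM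
      have hM0 : 0 ≤ M := by positivity
      have hdiff' := mul_le_mul_of_nonneg_left hdiff (show 0 ≤ 1 / (2 * σ k) by positivity)
      calc dualLasso b d (u (k + 1)) (v (k + 1)) - ginf
          ≤ ζ k ^ 2 * a ^ 2 / (2 * σ k) +
            1 / (2 * σ k) * (a * (euclNorm (x (k + 1)) + euclNorm (x k))) := by linarith
        _ = ((σ k)⁻¹ * a) * (M / 2) := by rw [hM]; field_simp; ring
        _ ≤ (ς k * distSet (x k) S) * (M / 2) := by
            exact mul_le_mul_of_nonneg_right (hres_le k) (by positivity)
        _ = ς' k * distSet (x k) S := by rw [hς']; ring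
  · intro σinf hσ
    rw [hρ]
    refine tendsto_rate hζ0 (tendsto_const_nhds.div
      ((tendsto_const_nhds.add (hσ.pow 2)).sqrt) ?_)
    positivity
  · intro hσ
    rw [hρ]
    refine tendsto_rate hζ0 (Tendsto.div_atTop tendsto_const_nhds ?_)
    refine tendsto_atTop_mono (fun k => ?_) hσ
    exact Real.le_sqrt_of_sq_le (by nlinarith [sq_nonneg κφ])
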